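/- The completeness translation respects the equivalence of categorical derivations: for all categorical derivations f, g : A ⟶ C, if f ≐ g then cmplt f ◦≐ cmplt g. -/

import Mathlib

set_option linter.unusedVariables false
inductive Fma (V : Type) : Type
  | var : V → Fma V
  | unit : Fma V
  | tens : Fma V → Fma V → Fma V

abbrev Stp (V : Type) := Option (Fma V)

def stpF {V : Type} : Stp V → Fma V
  | none => Fma.unit
  | some A => A

def semF {V : Type} : Fma V → List (Fma V) → Fma V
  | A, [] => A
  | A, B :: Γ => semF (A.tens B) Γ

abbrev sem {V : Type} (S : Stp V) (Γ : List (Fma V)) : Fma V := semF (stpF S) Γ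

theorem semF_append {V : Type} (A : Fma V) (Γ Δ : List (Fma V)) :
    semF A (Γ ++ Δ) = semF (semF A Γ) Δ := by
  induction Γ generalizing A with
  | nil => rfl
  | cons B Γ ih => exact ih _

/-- The categorical calculus: derivations A ⟶ C of the free skew monoidal category. -/
inductive Der {V : Type} : Fma V → Fma V → Type
  | id : Der A A
  | comp : Der B C → Der A B → Der A C
  | tens : Der A C → Der B D → Der (Fma.tens A B) (Fma.tens C D)
  | lam : Der (Fma.tens Fma.unit A) A
  | rho : Der A (Fma.tens A Fma.unit)
  | alpha : Der (Fma.tens (Fma.tens A B) C) (Fma.tens A (Fma.tens B C))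

/-- The cut-free skew monoidal sequent calculus. -/
inductive CF {V : Type} : Stp V → List (Fma V) → Fma V → Type
  | ax : CF (some A) [] A
  | uf : CF (some A) Γ C → CF none (A :: Γ) C
  | Il : CF none Γ C → CF (some Fma.unit) Γ C
  | Ir : CF none [] Fma.unit
  | tl : CF (some A) (B :: Γ) C → CF (some (Fma.tens A B)) Γ C
  | tr : CF S Γ A → CF none Δ B → CF S (Γ ++ Δ) (Fma.tens A B)

inductive DerEq {V : Type} : {A C : Fma V} → Der A C → Der A C → Prop
  | refl : DerEq f f
  | symm : DerEq f g → DerEq g f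
  | trans : DerEq f g → DerEq g h → DerEq f h
  | compCong : DerEq g g' → DerEq f f' → DerEq (Der.comp g f) (Der.comp g' f')
  | tensCong : DerEq f f' → DerEq g g' → DerEq (Der.tens f g) (Der.tens f' g')
  | compIdL : DerEq (Der.comp Der.id f) f
  | compIdR : DerEq (Der.comp f Der.id) f
  | compAssoc : DerEq (Der.comp h (Der.comp g f)) (Der.comp (Der.comp h g) f)
  | tensId : DerEq (Der.tens (Der.id (A := A)) (Der.id (A := B))) Der.id
  | tensComp : DerEq (Der.tens (Der.comp g f) (Der.comp k h))
      (Der.comp (Der.tens g k) (Der.tens f h))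
  | natLam : DerEq (Der.comp f Der.lam) (Der.comp Der.lam (Der.tens Der.id f))
  | natRho : DerEq (Der.comp Der.rho f) (Der.comp (Der.tens f Der.id) Der.rho)
  | natAlpha : DerEq (Der.comp Der.alpha (Der.tens (Der.tens f g) h))
      (Der.comp (Der.tens f (Der.tens g h)) Der.alpha)
  | lamRho : DerEq (Der.comp Der.lam Der.rho) (Der.id (A := Fma.unit))
  | skewB : DerEq (Der.comp (Der.tens Der.id Der.lam) (Der.comp Der.alpha (Der.tens Der.rho Der.id)))
      (Der.id (A := Fma.tens A B))
  | skewC : DerEq (Der.comp Der.lam Der.alpha) (Der.tens Der.lam (Der.id (A := B)))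
  | skewD : DerEq (Der.comp Der.alpha Der.rho) (Der.tens (Der.id (A := A)) Der.rho)
  | skewE : DerEq
      (Der.comp (Der.tens Der.id Der.alpha) (Der.comp Der.alpha (Der.tens Der.alpha (Der.id (A := D)))))
      (Der.comp Der.alpha Der.alpha)

inductive CFEq {V : Type} : {S : Stp V} → {Γ : List (Fma V)} → {C : Fma V} → CF S Γ C → CF S Γ C → Prop
  | refl : CFEq f f
  | symm : CFEq f g → CFEq g f
  | trans : CFEq f g → CFEq g h → CFEq f h
  | ufCong : CFEq f g → CFEq (CF.uf f) (CF.uf g)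
  | IlCong : CFEq f g → CFEq (CF.Il f) (CF.Il g)
  | tlCong : CFEq f g → CFEq (CF.tl f) (CF.tl g)
  | trCong : CFEq f f' → CFEq g g' → CFEq (CF.tr f g) (CF.tr f' g')
  | axI : CFEq (CF.ax (A := Fma.unit (V := V))) (CF.Il CF.Ir)
  | axTens : CFEq (CF.ax (A := Fma.tens A B)) (CF.tl (CF.tr CF.ax (CF.uf CF.ax)))
  | trUf : CFEq (CF.tr (CF.uf f) g) (CF.uf (CF.tr f g))
  | trIl : CFEq (CF.tr (CF.Il f) g) (CF.Il (CF.tr f g))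
  | trTl : CFEq (CF.tr (CF.tl f) g) (CF.tl (CF.tr f g))

def splitList {α : Type} :
    (Λ₁ Λ₂ Δ₀ Δ₁ : List α) → (A : α) → Λ₁ ++ Λ₂ = Δ₀ ++ A :: Δ₁ →
      (Σ' Δ₁' : List α, (Λ₁ = Δ₀ ++ A :: Δ₁') ×' (Δ₁ = Δ₁' ++ Λ₂)) ⊕
      (Σ' Δ₀' : List α, (Λ₂ = Δ₀' ++ A :: Δ₁) ×' (Δ₀ = Λ₁ ++ Δ₀'))
  | [], Λ₂, Δ₀, Δ₁, A, h => .inr ⟨Δ₀, h, rfl⟩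
  | X :: Λ₁', Λ₂, [], Δ₁, A, h => by
      simp only [List.cons_append, List.nil_append] at h
      injection h with h1 h2
      subst h1
      exact .inl ⟨Λ₁', rfl, h2.symm⟩
  | X :: Λ₁', Λ₂, Y :: Δ₀', Δ₁, A, h => by
      simp only [List.cons_append] at h
      injection h with h1 h2
      subst h1
      rcases splitList Λ₁' Λ₂ Δ₀' Δ₁ A h2 with ⟨Δ₁', e1, e2⟩ | ⟨Δ₀'', e1, e2⟩
      · exact .inl ⟨Δ₁', by rw [e1]; simp, e2⟩
      · exact .inr ⟨Δ₀'', e1, by rw [e2]; simp⟩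

mutual
def scutCF : {V : Type} → {S : Stp V} → {Γ Δ : List (Fma V)} → {A C : Fma V} →
    CF S Γ A → CF (some A) Δ C → CF S (Γ ++ Δ) C
  | _, _, _, _, _, _, .ax, g => g
  | _, _, _, _, _, _, .uf f, g => .uf (scutCF f g)
  | _, _, _, _, _, _, .Il f, g => .Il (scutCF f g)
  | _, _, _, _, _, _, .tl f, g => .tl (scutCF f g)
  | _, _, _, _, _, _, .Ir, .ax => .Ir
  | _, _, _, _, _, _, .Ir, .Il g => g
  | _, _, _, _, _, _, .Ir, .tr g1 g2 => by
      simp only [List.nil_append]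
      exact .tr (scutCF .Ir g1) g2
  | _, _, _, _, _, _, .tr f1 f2, .ax => by
      rw [List.append_nil]; exact .tr f1 f2
  | _, _, _, _, _, _, .tr (Γ := Γ₁) f1 f2, .tl g => ccutCF Γ₁ f2 (scutCF f1 g) rfl
  | _, _, _, _, _, _, .tr f1 f2, .tr g1 g2 => by
      rw [← List.append_assoc]
      exact .tr (scutCF (.tr f1 f2) g1) g2
  termination_by V S Γ Δ A C f g => (sizeOf A, sizeOf g, sizeOf f)
  decreasing_by
    all_goals subst_vars
    all_goals simp_wf
    all_goals (first
      | (apply Prod.Lex.left; first | omega | (simp; omega))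
      | (apply Prod.Lex.right; first
          | (apply Prod.Lex.left; first | omega | (simp; omega))
          | (apply Prod.Lex.right; first | omega | (simp; omega))))

def ccutCF : {V : Type} → {S : Stp V} → {Γ Λ Δ₁ : List (Fma V)} → {A C : Fma V} →
    (Δ₀ : List (Fma V)) → CF none Γ A → (g : CF S Λ C) → Λ = Δ₀ ++ A :: Δ₁ →
    CF S ((Δ₀ ++ Γ) ++ Δ₁) C
  | _, _, _, _, _, _, _, _, _, .ax, h => by simp at h
  | _, _, _, _, _, _, _, _, _, .Ir, h => by simp at h
  | _, _, _, _, _, _, _, [], f, .uf g, h => by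
      simp only [List.nil_append] at h
      injection h with h1 h2
      subst h1; subst h2
      exact scutCF f g
  | _, _, _, _, _, _, _, A'' :: Δ₀', f, .uf g, h => by
      simp only [List.cons_append] at h
      injection h with h1 h2
      subst h1
      exact .uf (ccutCF Δ₀' f g h2)
  | _, _, _, _, _, _, _, Δ₀, f, .Il g, h => .Il (ccutCF Δ₀ f g h)
  | _, _, _, _, _, _, _, Δ₀, f, .tl (B := B) g, h => .tl (ccutCF (B :: Δ₀) f g (by simp [h]))
  | _, _, _, _, Δ₁, _, _, Δ₀, f, .tr (Γ := Λ₁) (Δ := Λ₂) g1 g2, h => by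
      rcases splitList Λ₁ Λ₂ Δ₀ _ _ h with ⟨Δ₁', h1, h2⟩ | ⟨Δ₀', h1, h2⟩
      · subst h2
        have e : ∀ Γ' : List _, (Δ₀ ++ Γ') ++ (Δ₁' ++ Λ₂) = ((Δ₀ ++ Γ') ++ Δ₁') ++ Λ₂ := by
          intro Γ'; simp
        rw [e]
        exact .tr (ccutCF Δ₀ f g1 h1) g2
      · subst h2
        have e : ∀ Γ' : List _, ((Λ₁ ++ Δ₀') ++ Γ') ++ Δ₁ = Λ₁ ++ ((Δ₀' ++ Γ') ++ Δ₁) := by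
          intro Γ'; simp
        rw [e]
        exact .tr g1 (ccutCF Δ₀' f g2 h1)
  termination_by V S Γ Λ Δ₁ A C Δ₀ f g h => (sizeOf A, sizeOf g, sizeOf f)
  decreasing_by
    all_goals subst_vars
    all_goals simp_wf
    all_goals (first
      | (apply Prod.Lex.left; first | omega | (simp; omega))
      | (apply Prod.Lex.right; first
          | (apply Prod.Lex.left; first | omega | (simp; omega))
          | (apply Prod.Lex.right; first | omega | (simp; omega))))
end

def cmpltCF {V : Type} {A C : Fma V} : Der A C → CF (some A) [] C
  | .id => .ax
  | .comp g f => scutCF (Γ := []) (Δ := []) (cmpltCF f) (cmpltCF g)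
  | .tens f g => .tl (.tr (cmpltCF f) (.uf (cmpltCF g)))
  | .lam => .tl (.Il (.uf .ax))
  | .rho => .tr .ax .Ir
  | .alpha => .tl (.tl (.tr .ax (.uf (.tr .ax (.uf .ax)))))

namespace CF

variable {V : Type}

/-- Equivalence of cut-free derivations whose contexts are only propositionally equal. -/
def HE {S : Stp V} {Γ Γ' : List (Fma V)} {C : Fma V} (f : CF S Γ C) (g : CF S Γ' C) : Prop :=
  ∃ e : Γ = Γ', CFEq (e ▸ f) g

variable {S : Stp V} {Γ Γ' Γ'' Δ Δ' Δ₁ Δ₁' Δ₂ Λ Λ' Θ Θ' : List (Fma V)} {A B C D X : Fma V}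

theorem HE.of {f g : CF S Γ C} (h : CFEq f g) : HE f g := ⟨rfl, h⟩

theorem HE.out {f g : CF S Γ C} (h : HE f g) : CFEq f g := h.2

theorem HE.refl (f : CF S Γ C) : HE f f := .of .refl

theorem HE.symm {f : CF S Γ C} {g : CF S Γ' C} (h : HE f g) : HE g f := by
  obtain ⟨rfl, h⟩ := h
  exact .of h.symm

theorem HE.trans {f : CF S Γ C} {g : CF S Γ' C} {k : CF S Γ'' C} (h : HE f g) (h' : HE g k) :
    HE f k := by
  obtain ⟨rfl, h⟩ := h
  obtain ⟨rfl, h'⟩ := h'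
  exact .of (h.trans h')

theorem HE.mpr (e : Γ' = Γ) (h : CF S Γ C = CF S Γ' C) (f : CF S Γ' C) : HE (h.mpr f) f := by
  subst e
  exact .refl f

theorem HE.uf {f : CF (some A) Γ C} {g : CF (some A) Γ' C} (h : HE f g) :
    HE (CF.uf f) (CF.uf g) := by
  obtain ⟨rfl, h⟩ := h
  exact .of (.ufCong h)

theorem HE.il {f : CF none Γ C} {g : CF none Γ' C} (h : HE f g) : HE (CF.Il f) (CF.Il g) := by
  obtain ⟨rfl, h⟩ := h
  exact .of (.IlCong h)

theorem HE.tl {f : CF (some A) (B :: Γ) C} {g : CF (some A) (B :: Γ') C} (h : HE f g) :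
    HE (CF.tl f) (CF.tl g) := by
  obtain ⟨e, h⟩ := h
  cases e
  exact .of (.tlCong h)

theorem HE.tr {f : CF S Γ A} {f' : CF S Γ' A} {g : CF none Δ B} {g' : CF none Δ' B}
    (h : HE f f') (h' : HE g g') : HE (CF.tr f g) (CF.tr f' g') := by
  obtain ⟨rfl, h⟩ := h
  obtain ⟨rfl, h'⟩ := h'
  exact .of (.trCong h h')

theorem tr_uf (f : CF (some X) Γ A) (g : CF none Δ B) :
    HE (CF.tr (CF.uf f) g) (CF.uf (CF.tr f g)) := .of .trUf

theorem tr_il (f : CF none Γ A) (g : CF none Δ B) :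
    HE (CF.tr (CF.Il f) g) (CF.Il (CF.tr f g)) := .of .trIl

theorem tr_tl (f : CF (some X) (D :: Γ) A) (g : CF none Δ B) :
    HE (CF.tr (CF.tl f) g) (CF.tl (CF.tr f g)) := .of .trTl

theorem tens_ind {P : ∀ S Γ, CF S Γ (A.tens B) → Prop}
    (ax : P _ _ .ax)
    (uf : ∀ X Γ (f : CF (some X) Γ _), P _ _ f → P _ _ (.uf f))
    (il : ∀ Γ (f : CF none Γ _), P _ _ f → P _ _ (.Il f))
    (tl : ∀ X Y Γ (f : CF (some X) (Y :: Γ) _), P _ _ f → P _ _ (.tl f))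
    (tr : ∀ S Γ Δ (f : CF S Γ A) (g : CF none Δ B), P _ _ (.tr f g))
    {S Γ} (h : CF S Γ (A.tens B)) : P S Γ h := by
  suffices ∀ C (hC : C = A.tens B) (h : CF S Γ C), P S Γ (hC ▸ h) from this _ rfl h
  clear h
  intro C hC h
  induction h with
  | ax => subst hC; exact ax
  | uf f ih => subst hC; exact uf _ _ f (ih rfl)
  | Il f ih => subst hC; exact il _ f (ih rfl)
  | tl f ih => subst hC; exact tl _ _ _ f (ih rfl)
  | Ir => cases hC
  | tr f g => cases hC; exact tr _ _ _ f g

theorem unit_ind {P : ∀ S Γ, CF S Γ (Fma.unit : Fma V) → Prop}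
    (ax : P _ _ .ax)
    (uf : ∀ X Γ (f : CF (some X) Γ _), P _ _ f → P _ _ (.uf f))
    (il : ∀ Γ (f : CF none Γ _), P _ _ f → P _ _ (.Il f))
    (tl : ∀ X Y Γ (f : CF (some X) (Y :: Γ) _), P _ _ f → P _ _ (.tl f))
    (ir : P _ _ .Ir)
    {S Γ} (h : CF S Γ (Fma.unit : Fma V)) : P S Γ h := by
  suffices ∀ C (hC : C = Fma.unit) (h : CF S Γ C), P S Γ (hC ▸ h) from this _ rfl h
  clear h
  intro C hC h
  induction h with
  | ax => subst hC; exact ax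
  | uf f ih => subst hC; exact uf _ _ f (ih rfl)
  | Il f ih => subst hC; exact il _ f (ih rfl)
  | tl f ih => subst hC; exact tl _ _ _ f (ih rfl)
  | Ir => exact ir
  | tr f g => cases hC

/-! ### Computation rules for the cuts -/

theorem scut_ax_left (k : CF (some A) Δ C) : HE (scutCF .ax k) k := by
  rw [scutCF]; exact .refl _

theorem scut_uf (f : CF (some X) Γ A) (k : CF (some A) Δ C) :
    HE (scutCF (.uf f) k) (.uf (scutCF f k)) := by
  rw [scutCF]; exact .refl _

theorem scut_il (f : CF none Γ A) (k : CF (some A) Δ C) :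
    HE (scutCF (.Il f) k) (.Il (scutCF f k)) := by
  rw [scutCF]; exact .refl _

theorem scut_tl (f : CF (some X) (B :: Γ) A) (k : CF (some A) Δ C) :
    HE (scutCF (.tl f) k) (.tl (scutCF f k)) := by
  rw [scutCF]; exact .refl _

theorem scut_ir_il (k : CF none Δ C) : HE (scutCF .Ir (.Il k)) k := by
  rw [scutCF]; exact .refl _

theorem scut_ir_tr (a : CF (some Fma.unit) Γ A) (b : CF none Δ B) :
    HE (scutCF .Ir (.tr a b)) (.tr (scutCF .Ir a) b) := by
  rw [scutCF]; exact .refl _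

theorem scut_tr_tl (f : CF S Γ A) (g : CF none Δ B) (k : CF (some A) (B :: Θ) C) :
    HE (scutCF (.tr f g) (.tl k)) (ccutCF Γ g (scutCF f k) rfl) := by
  rw [scutCF]; exact .refl _

theorem scut_tr_tr (f : CF S Γ A) (g : CF none Δ B) (a : CF (some (A.tens B)) Λ C)
    (b : CF none Θ D) :
    HE (scutCF (.tr f g) (.tr a b)) (.tr (scutCF (.tr f g) a) b) := by
  rw [scutCF]; exact HE.mpr (by simp) _ _

theorem scut_ax (h : CF S Γ A) : HE (scutCF h .ax) h := by
  induction h with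
  | ax => exact scut_ax_left _
  | uf f ih => exact (scut_uf _ _).trans ih.uf
  | Il f ih => exact (scut_il _ _).trans ih.il
  | tl f ih => exact (scut_tl _ _).trans (HE.tl ih)
  | Ir => rw [scutCF]; exact .refl _
  | tr f g _ _ => rw [scutCF]; exact HE.mpr (by simp) _ _

theorem scut_tr (h : CF S Γ A) (a : CF (some A) Δ C) (b : CF none Θ D) :
    HE (scutCF h (.tr a b)) (.tr (scutCF h a) b) := by
  induction h with
  | ax => exact (scut_ax_left _).trans (HE.tr (scut_ax_left _).symm (.refl _))
  | uf f ih =>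
    exact (scut_uf _ _).trans ((ih a).uf.trans
      ((HE.tr (scut_uf _ _) (.refl _)).trans (tr_uf _ _)).symm)
  | Il f ih =>
    exact (scut_il _ _).trans ((ih a).il.trans
      ((HE.tr (scut_il _ _) (.refl _)).trans (tr_il _ _)).symm)
  | tl f ih =>
    exact (scut_tl _ _).trans ((HE.tl (ih a)).trans
      ((HE.tr (scut_tl _ _) (.refl _)).trans (tr_tl _ _)).symm)
  | Ir => exact scut_ir_tr _ _
  | tr f g _ _ => exact scut_tr_tr _ _ _ _

theorem ccut_uf_nil (f : CF none Γ A) (k : CF (some A) Λ C) (e : A :: Λ = [] ++ A :: Δ₁) :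
    HE (ccutCF [] f (.uf k) e) (scutCF f k) := by
  cases e
  rw [ccutCF]; exact .refl _

theorem ccut_uf_cons (f : CF none Γ A) (k : CF (some X) Λ C) (e : X :: Λ = (D :: Δ) ++ A :: Δ₁)
    (e' : Λ = Δ ++ A :: Δ₁) :
    HE (ccutCF (D :: Δ) f (.uf k) e) (.uf (ccutCF Δ f k e')) := by
  cases e
  rw [ccutCF]; exact .refl _

theorem ccut_il (f : CF none Γ A) (k : CF none Λ C) (e : Λ = Δ ++ A :: Δ₁) :
    HE (ccutCF Δ f (.Il k) e) (.Il (ccutCF Δ f k e)) := by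
  rw [ccutCF]; exact .refl _

theorem ccut_tl (f : CF none Γ A) (k : CF (some X) (B :: Λ) C) (e : Λ = Δ ++ A :: Δ₁)
    (e' : B :: Λ = (B :: Δ) ++ A :: Δ₁) :
    HE (ccutCF Δ f (.tl k) e) (.tl (ccutCF (B :: Δ) f k e')) := by
  rw [ccutCF]; exact .refl _

theorem ccut_tr_left (f : CF none Γ A) (a : CF S Λ C) (b : CF none Λ' D)
    (e : Λ ++ Λ' = Δ ++ A :: Δ₁) (e' : Λ = Δ ++ A :: Δ₁') :
    HE (ccutCF Δ f (.tr a b) e) (.tr (ccutCF Δ f a e') b) := by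
  rw [ccutCF]
  rcases splitList Λ Λ' Δ Δ₁ A e with ⟨Δ₂, h1, h2⟩ | ⟨Δ₂, h1, h2⟩
  · subst h2
    have : Δ₂ = Δ₁' := by simpa using h1.symm.trans e'
    subst this
    exact HE.mpr (by simp) _ _
  · have := congrArg List.length e'
    have := congrArg List.length h2
    simp at *
    omega

theorem ccut_tr_right (f : CF none Γ A) (a : CF S Λ C) (b : CF none Λ' D)
    (e : Λ ++ Λ' = Δ ++ A :: Δ₁) (e' : Λ' = Δ' ++ A :: Δ₁) (eΔ : Δ = Λ ++ Δ') :
    HE (ccutCF Δ f (.tr a b) e) (.tr a (ccutCF Δ' f b e')) := by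
  rw [ccutCF]
  rcases splitList Λ Λ' Δ Δ₁ A e with ⟨Δ₂, h1, h2⟩ | ⟨Δ₂, h1, h2⟩
  · have := congrArg List.length h1
    have := congrArg List.length eΔ
    simp at *
    omega
  · subst h2
    have : Δ₂ = Δ' := by simpa using eΔ
    subst this
    exact HE.mpr (by simp) _ _

/-! ### Congruence of the cuts in their second argument -/

/-- Cutting along the formula `A` in the stoup respects equivalence of the second premise. -/
def ScutCongr (A : Fma V) : Prop :=
  ∀ {S : Stp V} {Γ Δ : List (Fma V)} {C : Fma V} (h : CF S Γ A) {k k' : CF (some A) Δ C},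
    CFEq k k' → HE (scutCF h k) (scutCF h k')

theorem ccut_congr_of (hA : ScutCongr A) {g g' : CF S Λ C} (h : CFEq g g') :
    ∀ {Γ Δ Δ₁} (f : CF none Γ A) (e : Λ = Δ ++ A :: Δ₁),
      HE (ccutCF Δ f g e) (ccutCF Δ f g' e) := by
  induction h with
  | refl => intros; exact .refl _
  | symm _ ih => intro _ _ _ f e; exact (ih f e).symm
  | trans _ _ ih ih' => intro _ _ _ f e; exact (ih f e).trans (ih' f e)
  | ufCong h ih =>
    intro Γ Δ Δ₁ f e
    cases Δ with
    | nil =>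
      cases e
      exact (ccut_uf_nil _ _ _).trans ((hA f h).trans (ccut_uf_nil _ _ _).symm)
    | cons Y Δ =>
      have e' := (List.cons.inj e).2
      exact (ccut_uf_cons _ _ _ e').trans ((ih f e').uf.trans (ccut_uf_cons _ _ _ e').symm)
  | IlCong _ ih =>
    intro Γ Δ Δ₁ f e
    exact (ccut_il _ _ _).trans ((ih f e).il.trans (ccut_il _ _ _).symm)
  | @tlCong _ Y _ _ _ _ _ ih =>
    intro Γ Δ Δ₁ f e
    have e' := congrArg (List.cons Y) e
    exact (ccut_tl _ _ _ e').trans ((HE.tl (ih f e')).trans (ccut_tl _ _ _ e').symm)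
  | trCong h h' ih ih' =>
    intro Γ Δ Δ₁ f e
    obtain ⟨Δ₂, e₁, e₂⟩ | ⟨Δ₂, e₁, e₂⟩ := splitList _ _ _ _ _ e
    · exact (ccut_tr_left _ _ _ _ e₁).trans ((HE.tr (ih f e₁) (.of h')).trans
        (ccut_tr_left _ _ _ _ e₁).symm)
    · exact (ccut_tr_right _ _ _ _ e₁ e₂).trans ((HE.tr (.of h) (ih' f e₁)).trans
        (ccut_tr_right _ _ _ _ e₁ e₂).symm)
  | axI => intro _ _ _ f e; simp at e
  | axTens => intro _ _ _ f e; simp at e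
  | @trUf Y Λ =>
    intro Γ Δ Δ₁ f e
    cases Δ with
    | nil =>
      cases e
      exact (ccut_tr_left _ _ _ _ rfl).trans ((HE.tr (ccut_uf_nil _ _ _) (.refl _)).trans
        ((scut_tr _ _ _).symm.trans (ccut_uf_nil _ _ _).symm))
    | cons Z Δ =>
      have e' := (List.cons.inj e).2
      obtain ⟨Δ₂, e₁, e₂⟩ | ⟨Δ₂, e₁, e₂⟩ := splitList _ _ _ _ _ e'
      · have e₃ : Y :: Λ = (Z :: Δ) ++ A :: Δ₂ := by rw [(List.cons.inj e).1, e₁]; rfl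
        exact (ccut_tr_left _ _ _ _ e₃).trans <|
          (HE.tr (ccut_uf_cons _ _ _ e₁) (.refl _)).trans <| (tr_uf _ _).trans <|
          (ccut_tr_left _ _ _ e' e₁).uf.symm.trans (ccut_uf_cons _ _ _ e').symm
      · have e₃ : Z :: Δ = (Y :: Λ) ++ Δ₂ := by rw [(List.cons.inj e).1, e₂]; rfl
        exact (ccut_tr_right _ _ _ _ e₁ e₃).trans <| (tr_uf _ _).trans <|
          (ccut_tr_right _ _ _ e' e₁ e₂).uf.symm.trans (ccut_uf_cons _ _ _ e').symm
  | trIl =>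
    intro Γ Δ Δ₁ f e
    obtain ⟨Δ₂, e₁, e₂⟩ | ⟨Δ₂, e₁, e₂⟩ := splitList _ _ _ _ _ e
    · exact (ccut_tr_left _ _ _ _ e₁).trans <| (HE.tr (ccut_il _ _ _) (.refl _)).trans <|
        (tr_il _ _).trans <| (ccut_tr_left _ _ _ e e₁).il.symm.trans (ccut_il _ _ _).symm
    · exact (ccut_tr_right _ _ _ _ e₁ e₂).trans <| (tr_il _ _).trans <|
        (ccut_tr_right _ _ _ e e₁ e₂).il.symm.trans (ccut_il _ _ _).symm
  | @trTl _ Y =>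
    intro Γ Δ Δ₁ f e
    have e' := congrArg (List.cons Y) e
    obtain ⟨Δ₂, e₁, e₂⟩ | ⟨Δ₂, e₁, e₂⟩ := splitList _ _ _ _ _ e
    · have e₃ := congrArg (List.cons Y) e₁
      exact (ccut_tr_left _ _ _ _ e₁).trans <| (HE.tr (ccut_tl _ _ _ e₃) (.refl _)).trans <|
        (tr_tl _ _).trans <|
        (HE.tl (ccut_tr_left _ _ _ e' e₃)).symm.trans (ccut_tl _ _ _ e').symm
    · have e₃ := congrArg (List.cons Y) e₂
      exact (ccut_tr_right _ _ _ _ e₁ e₂).trans <| (tr_tl _ _).trans <|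
        (HE.tl (ccut_tr_right _ _ _ e' e₁ e₃)).symm.trans (ccut_tl _ _ _ e').symm

theorem ccut_he_of (hA : ScutCongr A) {g : CF S Λ C} {g' : CF S Λ' C} (h : HE g g')
    (f : CF none Γ A) (e : Λ = Δ ++ A :: Δ₁) (e' : Λ' = Δ' ++ A :: Δ₁') (eΔ : Δ = Δ') :
    HE (ccutCF Δ f g e) (ccutCF Δ' f g' e') := by
  obtain ⟨rfl, h⟩ := h
  subst eΔ
  obtain rfl : Δ₁ = Δ₁' := by simpa using e.symm.trans e'
  exact ccut_congr_of hA h f e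

theorem scut_ir_congr {k k' : CF (some Fma.unit) Δ C} (h : CFEq k k') :
    HE (scutCF .Ir k) (scutCF .Ir k') := by
  suffices ∀ {S : Stp V} {Δ C} {k k' : CF S Δ C} (h : CFEq k k') (e : S = some Fma.unit),
    HE (scutCF .Ir (e ▸ k : CF (some Fma.unit) Δ C)) (scutCF .Ir (e ▸ k')) from this h rfl
  clear h
  intro S Δ C k k' h
  induction h with
  | refl => intros; exact .refl _
  | symm _ ih => intro e; exact (ih e).symm
  | trans _ _ ih ih' => intro e; exact (ih e).trans (ih' e)
  | ufCong => intro e; cases e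
  | IlCong h => intro e; exact (scut_ir_il _).trans ((HE.of h).trans (scut_ir_il _).symm)
  | tlCong => intro e; cases e
  | trCong _ h' ih =>
    intro e
    subst e
    exact (scut_ir_tr _ _).trans ((HE.tr (ih rfl) (.of h')).trans (scut_ir_tr _ _).symm)
  | axI => intro e; exact (scut_ax _).trans (scut_ir_il _).symm
  | axTens => intro e; cases e
  | trUf => intro e; cases e
  | trIl =>
    intro e
    exact (scut_ir_tr _ _).trans <| (HE.tr (scut_ir_il _) (.refl _)).trans (scut_ir_il _).symm
  | trTl => intro e; cases e

theorem scut_tr_congr (hA : ScutCongr A) (hB : ScutCongr B) (a : CF S Γ A) (b : CF none Θ B)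
    {k k' : CF (some (A.tens B)) Δ C} (h : CFEq k k') :
    HE (scutCF (.tr a b) k) (scutCF (.tr a b) k') := by
  suffices ∀ {S' : Stp V} {Δ C} {k k' : CF S' Δ C} (h : CFEq k k') (e : S' = some (A.tens B)),
    HE (scutCF (.tr a b) (e ▸ k : CF (some (A.tens B)) Δ C)) (scutCF (.tr a b) (e ▸ k')) from
    this h rfl
  clear h
  intro S' Δ C k k' h
  induction h with
  | refl => intros; exact .refl _
  | symm _ ih => intro e; exact (ih e).symm
  | trans _ _ ih ih' => intro e; exact (ih e).trans (ih' e)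
  | ufCong => intro e; cases e
  | IlCong h => intro e; cases e
  | tlCong h =>
    intro e
    cases e
    refine (scut_tr_tl _ _ _).trans (HE.trans ?_ (scut_tr_tl _ _ _).symm)
    exact ccut_congr_of hB (hA a h).out _ _
  | trCong _ h' ih =>
    intro e
    subst e
    exact (scut_tr _ _ _).trans ((HE.tr (ih rfl) (.of h')).trans (scut_tr _ _ _).symm)
  | axI => intro e; cases e
  | axTens =>
    intro e
    cases e
    refine (scut_ax _).trans (HE.trans ?_ (scut_tr_tl _ _ _).symm)
    refine HE.trans ?_ (ccut_he_of hB ((scut_tr a .ax (.uf .ax)).trans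
      (HE.tr (scut_ax a) (.refl _))).symm _ rfl _ rfl)
    exact ((ccut_tr_right _ _ _ _ rfl (by simp)).trans
      (HE.tr (.refl _) ((ccut_uf_nil _ _ _).trans (scut_ax _)))).symm
  | trUf => intro e; cases e
  | trIl => intro e; cases e
  | trTl =>
    intro e
    cases e
    exact (scut_tr _ _ _).trans <| (HE.tr (scut_tr_tl _ _ _) (.refl _)).trans <|
      (ccut_tr_left _ _ _ (List.append_assoc _ _ _) rfl).symm.trans <|
      (ccut_he_of hB (scut_tr _ _ _).symm _ _ _ rfl).trans (scut_tr_tl _ _ _).symm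

theorem scut_congr_of (hA : ∀ A₁ A₂, A = A₁.tens A₂ → ScutCongr A₁ ∧ ScutCongr A₂) :
    ScutCongr A := by
  intro S Γ Δ C h k k' hk
  induction h with
  | ax => exact (scut_ax_left _).trans ((HE.of hk).trans (scut_ax_left _).symm)
  | uf f ih => exact (scut_uf _ _).trans ((ih hA hk).uf.trans (scut_uf _ _).symm)
  | Il f ih => exact (scut_il _ _).trans ((ih hA hk).il.trans (scut_il _ _).symm)
  | tl f ih => exact (scut_tl _ _).trans ((HE.tl (ih hA hk)).trans (scut_tl _ _).symm)
  | Ir => exact scut_ir_congr hk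
  | tr a b => exact scut_tr_congr (hA _ _ rfl).1 (hA _ _ rfl).2 a b hk

theorem scutCongr (A : Fma V) : ScutCongr A := by
  induction A with
  | var => exact scut_congr_of fun _ _ e => by cases e
  | unit => exact scut_congr_of fun _ _ e => by cases e
  | tens A B ihA ihB => exact scut_congr_of fun _ _ e => by cases e; exact ⟨ihA, ihB⟩

theorem scut_he (h : CF S Γ A) {k : CF (some A) Δ C} {k' : CF (some A) Δ' C} (hk : HE k k') :
    HE (scutCF h k) (scutCF h k') := by
  obtain ⟨rfl, hk⟩ := hk
  exact scutCongr A h hk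

theorem ccut_he {g : CF S Λ C} {g' : CF S Λ' C} (h : HE g g')
    (f : CF none Γ A) (e : Λ = Δ ++ A :: Δ₁) (e' : Λ' = Δ' ++ A :: Δ₁') (eΔ : Δ = Δ') :
    HE (ccutCF Δ f g e) (ccutCF Δ' f g' e') :=
  ccut_he_of (scutCongr A) h f e e' eΔ

/-! ### Families of maps commuting with the left rules -/

/-- Transport of a derivation along an equality of contexts. -/
def castCtx (e : Γ = Γ') (f : CF S Γ C) : CF S Γ' C := e ▸ f

theorem castCtx_he (e : Γ = Γ') (f : CF S Γ C) : HE (castCtx e f) f := by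
  subst e
  exact .refl f

/-- A family of maps on derivations of `A`, compatible with equivalence and the left rules. -/
structure Fam (A : Fma V) (Θ : List (Fma V)) (C : Fma V) where
  map : ∀ {S : Stp V} {Γ : List (Fma V)}, CF S Γ A → CF S (Γ ++ Θ) C
  cong : ∀ {S : Stp V} {Γ : List (Fma V)} {f g : CF S Γ A}, CFEq f g → HE (map f) (map g)
  uf : ∀ {X : Fma V} {Γ : List (Fma V)} (f : CF (some X) Γ A), HE (map (.uf f)) (.uf (map f))
  il : ∀ {Γ : List (Fma V)} (f : CF none Γ A), HE (map (.Il f)) (.Il (map f))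
  tl : ∀ {X Y : Fma V} {Γ : List (Fma V)} (f : CF (some X) (Y :: Γ) A),
    HE (map (.tl f)) (.tl (Γ := Γ ++ Θ) (map f))

theorem Fam.he (φ : Fam A Θ C) {f : CF S Γ A} {g : CF S Γ' A} (h : HE f g) :
    HE (φ.map f) (φ.map g) := by
  obtain ⟨rfl, h⟩ := h
  exact φ.cong h

theorem Fam.ext_tens (φ : Fam (A.tens B) Θ C) (ψ : Fam (A.tens B) Θ' C)
    (h : ∀ {S : Stp V} {Γ Δ : List (Fma V)} (a : CF S Γ A) (b : CF none Δ B),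
      HE (φ.map (.tr a b)) (ψ.map (.tr a b)))
    (k : CF S Γ (A.tens B)) : HE (φ.map k) (ψ.map k) := by
  induction k using tens_ind with
  | ax =>
    exact (φ.cong .axTens).trans <| (φ.tl _).trans <| (HE.tl (h _ _)).trans <|
      (ψ.tl _).symm.trans (ψ.cong .axTens).symm
  | uf _ _ f ih => exact (φ.uf f).trans (ih.uf.trans (ψ.uf f).symm)
  | il _ f ih => exact (φ.il f).trans (ih.il.trans (ψ.il f).symm)
  | tl _ _ _ f ih => exact (φ.tl f).trans ((HE.tl ih).trans (ψ.tl f).symm)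
  | tr _ _ _ a b => exact h a b

theorem Fam.ext_unit (φ : Fam (Fma.unit : Fma V) Θ C) (ψ : Fam (Fma.unit : Fma V) Θ' C)
    (h : HE (φ.map .Ir) (ψ.map .Ir))
    (k : CF S Γ Fma.unit) : HE (φ.map k) (ψ.map k) := by
  induction k using unit_ind with
  | ax =>
    exact (φ.cong .axI).trans <| (φ.il _).trans <| h.il.trans <|
      (ψ.il _).symm.trans (ψ.cong .axI).symm
  | uf _ _ f ih => exact (φ.uf f).trans (ih.uf.trans (ψ.uf f).symm)
  | il _ f ih => exact (φ.il f).trans (ih.il.trans (ψ.il f).symm)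
  | tl _ _ _ f ih => exact (φ.tl f).trans ((HE.tl ih).trans (ψ.tl f).symm)
  | ir => exact h

/-- The family pairing a derivation with `b` by the right tensor rule. -/
def Fam.trRight (A : Fma V) (b : CF none Θ B) : Fam A Θ (A.tens B) where
  map a := .tr a b
  cong h := .of (.trCong h .refl)
  uf f := tr_uf f b
  il f := tr_il f b
  tl f := tr_tl f b

def Fam.comp (ψ : Fam B Θ' C) (φ : Fam A Θ B) : Fam A (Θ ++ Θ') C where
  map a := castCtx (by simp) (ψ.map (φ.map a))
  cong h := (castCtx_he _ _).trans ((ψ.he (φ.cong h)).trans (castCtx_he _ _).symm)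
  uf f := (castCtx_he _ _).trans <| (ψ.he (φ.uf f)).trans <| (ψ.uf _).trans
    (castCtx_he _ _).symm.uf
  il f := (castCtx_he _ _).trans <| (ψ.he (φ.il f)).trans <| (ψ.il _).trans
    (castCtx_he _ _).symm.il
  tl f := (castCtx_he _ _).trans <| (ψ.he (φ.tl f)).trans <| (ψ.tl _).trans
    (HE.tl (castCtx_he _ _).symm)

theorem Fam.comp_map (ψ : Fam B Θ' C) (φ : Fam A Θ B) (a : CF S Γ A) :
    HE ((ψ.comp φ).map a) (ψ.map (φ.map a)) := castCtx_he _ _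

/-- The family cutting `h` into the fixed part of the context of a family. -/
def Fam.ccut (φ : Fam A (Δ ++ X :: Δ₁) C) (h : CF none Γ' X) : Fam A (Δ ++ Γ' ++ Δ₁) C where
  map {S Γ} a := castCtx (by simp) (ccutCF (Γ ++ Δ) (Δ₁ := Δ₁) h (φ.map a) (by simp))
  cong e := (castCtx_he _ _).trans ((ccut_he (φ.cong e) _ _ _ rfl).trans (castCtx_he _ _).symm)
  uf f := (castCtx_he _ _).trans <| (ccut_he (φ.uf f) _ _ (by simp) rfl).trans <|
    (ccut_uf_cons _ _ _ (by simp)).trans (castCtx_he _ _).symm.uf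
  il f := (castCtx_he _ _).trans <| (ccut_he (φ.il f) _ _ (by simp) rfl).trans <|
    (ccut_il _ _ _).trans (castCtx_he _ _).symm.il
  tl f := (castCtx_he _ _).trans <| (ccut_he (φ.tl f) _ _ (by simp) rfl).trans <|
    (ccut_tl _ _ _ (by simp)).trans (HE.tl (castCtx_he _ _).symm)

theorem Fam.ccut_map (φ : Fam A (Δ ++ X :: Δ₁) C) (h : CF none Γ' X) (a : CF S Γ A)
    (e : Γ ++ (Δ ++ X :: Δ₁) = Δ' ++ X :: Δ₁') (eΔ : Δ' = Γ ++ Δ) :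
    HE ((φ.ccut h).map a) (ccutCF Δ' h (φ.map a) e) :=
  (castCtx_he _ _).trans (ccut_he (.refl _) _ _ _ eΔ.symm)

/-- Derivations ending with the right tensor rule. -/
def IsTr : CF S Γ C → Prop
  | .tr _ _ => True
  | _ => False

/-- Compatibility of a family with cuts along `X` in the stoup, on derivations satisfying `P`. -/
def Fam.ScutStable (φ : Fam A Θ C)
    (P : ∀ {S : Stp V} {Γ : List (Fma V)}, CF S Γ A → Prop) (X : Fma V) : Prop :=
  ∀ {S : Stp V} {Γ Δ : List (Fma V)} (h : CF S Γ X) (k : CF (some X) Δ A),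
    P k → HE (scutCF h (φ.map k)) (φ.map (scutCF h k))

/-- Compatibility of a family with cuts along `X` in the context, on derivations satisfying `P`. -/
def Fam.CcutStable (φ : Fam A Θ C)
    (P : ∀ {S : Stp V} {Γ : List (Fma V)}, CF S Γ A → Prop) (X : Fma V) : Prop :=
  ∀ {S : Stp V} {Γ Λ Δ Δ₁ Δ₁' : List (Fma V)} (h : CF none Γ X) (k : CF S Λ A)
    (e : Λ = Δ ++ X :: Δ₁) (e' : Λ ++ Θ = Δ ++ X :: Δ₁'),
    P k → HE (ccutCF Δ h (φ.map k) e') (φ.map (ccutCF Δ h k e))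

theorem Fam.ccutStable_of (φ : Fam A Θ C) (hX : φ.ScutStable (fun _ => True) X)
    (htr : φ.CcutStable IsTr X) : φ.CcutStable (fun _ => True) X := by
  intro S Γ Λ Δ Δ₁ Δ₁' h k e e' _
  induction k generalizing Δ with
  | ax => simp at e
  | Ir => simp at e
  | uf f ih =>
    refine (ccut_he (φ.uf f) _ _ e' rfl).trans ?_
    cases Δ with
    | nil =>
      cases e
      exact (ccut_uf_nil _ _ e').trans ((hX h f trivial).trans (φ.he (ccut_uf_nil _ _ _)).symm)
    | cons Y Δ =>
      have e₁ := (List.cons.inj e).2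
      have e₂ := (List.cons.inj e').2
      exact (ccut_uf_cons _ _ _ e₂).trans <| (ih φ hX htr e₁ e₂).uf.trans <|
        (φ.uf _).symm.trans (φ.he (ccut_uf_cons _ _ _ e₁)).symm
  | Il f ih =>
    exact (ccut_he (φ.il f) _ _ e' rfl).trans <| (ccut_il _ _ _).trans <|
      (ih φ hX htr e e').il.trans <| (φ.il _).symm.trans (φ.he (ccut_il _ _ _)).symm
  | @tl _ Y _ _ f ih =>
    have e₁ := congrArg (List.cons Y) e
    have e₂ : (Y :: _) ++ Θ = (Y :: Δ) ++ X :: Δ₁' := congrArg (List.cons Y) e'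
    exact (ccut_he (φ.tl f) _ _ e' rfl).trans <| (ccut_tl _ _ _ e₂).trans <|
      (HE.tl (ih φ hX htr e₁ e₂)).trans <| (φ.tl _).symm.trans (φ.he (ccut_tl _ _ _ e₁)).symm
  | tr a b => exact htr _ _ _ _ trivial

theorem Fam.scutStable_of (φ : Fam A Θ C)
    (hax : ∀ {S : Stp V} {Γ : List (Fma V)} (h : CF S Γ A), HE (scutCF h (φ.map .ax)) (φ.map h))
    (htr : φ.ScutStable IsTr X)
    (hX : ∀ X₁ X₂, X = X₁.tens X₂ →
      φ.ScutStable (fun _ => True) X₁ ∧ φ.CcutStable (fun _ => True) X₂) :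
    φ.ScutStable (fun _ => True) X := by
  intro S Γ Δ h k _
  cases k with
  | ax => exact (hax h).trans (φ.he (scut_ax h)).symm
  | tr a b => exact htr _ _ trivial
  | Il k =>
    refine (scut_he h (φ.il k)).trans ?_
    clear htr
    induction h using unit_ind with
    | ax =>
      exact (scut_ax_left _).trans ((φ.il k).symm.trans (φ.he (scut_ax_left _)).symm)
    | uf _ _ f ih =>
      exact (scut_uf _ _).trans <| ih.uf.trans <| (φ.uf _).symm.trans (φ.he (scut_uf _ _)).symm
    | il _ f ih =>
      exact (scut_il _ _).trans <| ih.il.trans <| (φ.il _).symm.trans (φ.he (scut_il _ _)).symm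
    | tl _ _ _ f ih =>
      exact (scut_tl _ _).trans <| (HE.tl ih).trans <|
        (φ.tl _).symm.trans (φ.he (scut_tl _ _)).symm
    | ir => exact (scut_ir_il _).trans (φ.he (scut_ir_il _)).symm
  | tl k =>
    refine (scut_he h (φ.tl k)).trans ?_
    clear htr
    induction h using tens_ind with
    | ax =>
      exact (scut_ax_left _).trans ((φ.tl k).symm.trans (φ.he (scut_ax_left _)).symm)
    | uf _ _ f ih =>
      exact (scut_uf _ _).trans <| ih.uf.trans <| (φ.uf _).symm.trans (φ.he (scut_uf _ _)).symm
    | il _ f ih =>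
      exact (scut_il _ _).trans <| ih.il.trans <| (φ.il _).symm.trans (φ.he (scut_il _ _)).symm
    | tl _ _ _ f ih =>
      exact (scut_tl _ _).trans <| (HE.tl ih).trans <|
        (φ.tl _).symm.trans (φ.he (scut_tl _ _)).symm
    | tr _ _ _ a b =>
      obtain ⟨h₁, h₂⟩ := hX _ _ rfl
      exact (scut_tr_tl _ _ _).trans <|
        (ccut_he (h₁ a k trivial) _ _ (List.append_assoc _ _ _) rfl).trans <|
        (h₂ b _ rfl _ trivial).trans (φ.he (scut_tr_tl _ _ _)).symm

/-- A family compatible with both cuts. -/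
structure Act (A : Fma V) (Θ : List (Fma V)) (C : Fma V) extends Fam A Θ C where
  scut : ∀ {X : Fma V}, toFam.ScutStable (fun _ => True) X
  ccut : ∀ {X : Fma V}, toFam.CcutStable (fun _ => True) X

/-- Compatibility with cuts follows from the cases of identities and of right tensor rules. -/
def Act.ofFam (φ : Fam A Θ C)
    (hax : ∀ {S : Stp V} {Γ : List (Fma V)} (h : CF S Γ A), HE (scutCF h (φ.map .ax)) (φ.map h))
    (hs : ∀ {X : Fma V}, φ.ScutStable IsTr X) (hc : ∀ {X : Fma V}, φ.CcutStable IsTr X) :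
    Act A Θ C :=
  have key (X : Fma V) :
      φ.ScutStable (fun _ => True) X ∧ φ.CcutStable (fun _ => True) X := by
    induction X with
    | var Y =>
      have h : φ.ScutStable (fun _ => True) (.var Y) :=
        φ.scutStable_of hax hs (fun _ _ e => by cases e)
      exact ⟨h, φ.ccutStable_of h hc⟩
    | unit =>
      have h : φ.ScutStable (fun _ => True) .unit :=
        φ.scutStable_of hax hs (fun _ _ e => by cases e)
      exact ⟨h, φ.ccutStable_of h hc⟩
    | tens X₁ X₂ ih₁ ih₂ =>
      have h : φ.ScutStable (fun _ => True) (X₁.tens X₂) :=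
        φ.scutStable_of hax hs (fun _ _ e => by cases e; exact ⟨ih₁.1, ih₂.2⟩)
      exact ⟨h, φ.ccutStable_of h hc⟩
  { φ with
    scut := (key _).1
    ccut := (key _).2 }

/-! ### Maps out of tensor products and the unit -/

/-- A binary operation on derivations of `A` and `B` compatible with equivalence, the left rules
and cuts, from which a map on derivations of `A.tens B` is obtained. -/
structure Bil (A B : Fma V) (Θ : List (Fma V)) (C : Fma V) where
  map : ∀ {S : Stp V} {Γ Δ : List (Fma V)}, CF S Γ A → CF none Δ B → CF S (Γ ++ Δ ++ Θ) C
  he : ∀ {S : Stp V} {Γ Γ' Δ Δ' : List (Fma V)} {a : CF S Γ A} {a' : CF S Γ' A}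
    {b : CF none Δ B} {b' : CF none Δ' B}, HE a a' → HE b b' → HE (map a b) (map a' b')
  uf : ∀ {X : Fma V} {Γ Δ : List (Fma V)} (a : CF (some X) Γ A) (b : CF none Δ B),
    HE (map (.uf a) b) (.uf (map a b))
  il : ∀ {Γ Δ : List (Fma V)} (a : CF none Γ A) (b : CF none Δ B),
    HE (map (.Il a) b) (.Il (map a b))
  tl : ∀ {X Y : Fma V} {Γ Δ : List (Fma V)} (a : CF (some X) (Y :: Γ) A) (b : CF none Δ B),
    HE (map (.tl a) b) (.tl (Γ := Γ ++ Δ ++ Θ) (map a b))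
  scut : ∀ {S : Stp V} {X : Fma V} {Γ Γ' Δ : List (Fma V)} (h : CF S Γ' X)
    (a : CF (some X) Γ A) (b : CF none Δ B), HE (scutCF h (map a b)) (map (scutCF h a) b)
  ccut_left : ∀ {S : Stp V} {X : Fma V} {Γ Γ' Δ Λ Λ₁ Λ₁' : List (Fma V)} (h : CF none Γ' X)
    (a : CF S Γ A) (b : CF none Δ B) (e : Γ = Λ ++ X :: Λ₁)
    (e' : Γ ++ Δ ++ Θ = Λ ++ X :: Λ₁'),
    HE (ccutCF Λ h (map a b) e') (map (ccutCF Λ h a e) b)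
  ccut_right : ∀ {S : Stp V} {X : Fma V} {Γ Γ' Δ Λ Λ' Λ₁ Λ₁' : List (Fma V)} (h : CF none Γ' X)
    (a : CF S Γ A) (b : CF none Δ B) (e : Δ = Λ ++ X :: Λ₁)
    (e' : Γ ++ Δ ++ Θ = Λ' ++ X :: Λ₁'), Λ' = Γ ++ Λ →
    HE (ccutCF Λ' h (map a b) e') (map a (ccutCF Λ h b e))

def Bil.liftMap (K : Bil A B Θ C) : ∀ {S : Stp V} {Γ : List (Fma V)} {D : Fma V},
    CF S Γ D → D = A.tens B → CF S (Γ ++ Θ) C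
  | _, _, _, .ax, e => by subst e; exact .tl (Γ := Θ) (K.map .ax (.uf .ax))
  | _, _, _, .uf f, e => .uf (K.liftMap f e)
  | _, _, _, .Il f, e => .Il (K.liftMap f e)
  | _, _, _, .Ir, e => by cases e
  | _, _, _, .tl (Γ := Γ) f, e => .tl (Γ := Γ ++ Θ) (K.liftMap f e)
  | _, _, _, .tr a b, e => by cases e; exact K.map a b

theorem Bil.liftMap_cong (K : Bil A B Θ C) {f g : CF S Γ D} (h : CFEq f g) (e : D = A.tens B) :
    HE (K.liftMap f e) (K.liftMap g e) := by
  induction h with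
  | refl => exact .refl _
  | symm _ ih => exact (ih e).symm
  | trans _ _ ih ih' => exact (ih e).trans (ih' e)
  | ufCong _ ih => exact (ih e).uf
  | IlCong _ ih => exact (ih e).il
  | tlCong _ ih => exact HE.tl (ih e)
  | trCong h h' => cases e; exact K.he (.of h) (.of h')
  | axI => cases e
  | axTens => cases e; exact .refl _
  | trUf => cases e; exact K.uf _ _
  | trIl => cases e; exact K.il _ _
  | trTl => cases e; exact K.tl _ _

theorem Bil.liftMap_he (K : Bil A B Θ C) {f : CF S Γ (A.tens B)} {g : CF S Γ' (A.tens B)}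
    (h : HE f g) : HE (K.liftMap f rfl) (K.liftMap g rfl) := by
  obtain ⟨rfl, h⟩ := h
  exact K.liftMap_cong h rfl

/-- The map on derivations of a tensor product induced by a binary operation. -/
def Bil.lift (K : Bil A B Θ C) : Act (A.tens B) Θ C :=
  Act.ofFam
    { map := fun f => K.liftMap f rfl
      cong := fun h => K.liftMap_cong h rfl
      uf := fun _ => .refl _
      il := fun _ => .refl _
      tl := fun _ => .refl _ }
    (by
      intro S Γ h
      induction h using tens_ind with
      | ax => exact scut_ax_left _
      | uf _ _ f ih => exact (scut_uf _ _).trans ih.uf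
      | il _ f ih => exact (scut_il _ _).trans ih.il
      | tl _ _ _ f ih => exact (scut_tl _ _).trans (HE.tl ih)
      | tr _ Γ _ a b =>
        have e : Γ ++ [] ++ [B] ++ Θ = Γ ++ B :: Θ := by simp
        refine (scut_tr_tl _ _ _).trans ?_
        refine (ccut_he (K.scut a .ax (.uf .ax)) _ _ e rfl).trans ?_
        refine (K.ccut_right (Λ := []) b (scutCF a .ax) (.uf .ax) rfl e (by simp)).trans ?_
        exact K.he (scut_ax a) ((ccut_uf_nil _ _ _).trans (scut_ax b)))
    (by
      intro X S Γ Δ h k hk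
      cases k with
      | tr a b =>
        exact (K.scut h a b).trans (K.liftMap_he (scut_tr h a b)).symm
      | _ => exact hk.elim)
    (by
      intro X S Γ Λ Δ Δ₁ Δ₁' h k e e' hk
      cases k with
      | tr a b =>
        obtain ⟨Δ₂, e₁, e₂⟩ | ⟨Δ₂, e₁, e₂⟩ := splitList _ _ _ _ _ e
        · exact (K.ccut_left h a b e₁ e').trans
            (K.liftMap_he (ccut_tr_left h a b e e₁)).symm
        · exact (K.ccut_right h a b e₁ e' e₂).trans
            (K.liftMap_he (ccut_tr_right h a b e e₁ e₂)).symm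
      | _ => exact hk.elim)

theorem Bil.lift_ax (K : Bil A B Θ C) :
    HE (K.lift.map .ax) (.tl (Γ := Θ) (K.map .ax (.uf .ax))) := .refl _

def unitMap (c : CF none Θ C) : ∀ {S : Stp V} {Γ : List (Fma V)} {D : Fma V},
    CF S Γ D → D = Fma.unit → CF S (Γ ++ Θ) C
  | _, _, _, .ax, e => by subst e; exact .Il c
  | _, _, _, .uf f, e => .uf (unitMap c f e)
  | _, _, _, .Il f, e => .Il (unitMap c f e)
  | _, _, _, .Ir, _ => c
  | _, _, _, .tl (Γ := Γ) f, e => .tl (Γ := Γ ++ Θ) (unitMap c f e)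
  | _, _, _, .tr a b, e => by cases e

theorem unitMap_cong (c : CF none Θ C) {f g : CF S Γ D} (h : CFEq f g) (e : D = Fma.unit) :
    HE (unitMap c f e) (unitMap c g e) := by
  induction h with
  | refl => exact .refl _
  | symm _ ih => exact (ih e).symm
  | trans _ _ ih ih' => exact (ih e).trans (ih' e)
  | ufCong _ ih => exact (ih e).uf
  | IlCong _ ih => exact (ih e).il
  | tlCong _ ih => exact HE.tl (ih e)
  | trCong => cases e
  | axI => exact .refl _
  | axTens => cases e
  | trUf => cases e
  | trIl => cases e
  | trTl => cases e

/-- The map on derivations of the unit induced by a derivation with empty stoup. -/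
def unitLift (c : CF none Θ C) : Act Fma.unit Θ C :=
  Act.ofFam
    { map := fun f => unitMap c f rfl
      cong := fun h => unitMap_cong c h rfl
      uf := fun _ => .refl _
      il := fun _ => .refl _
      tl := fun _ => .refl _ }
    (by
      intro S Γ h
      induction h using unit_ind with
      | ax => exact scut_ax_left _
      | uf _ _ f ih => exact (scut_uf _ _).trans ih.uf
      | il _ f ih => exact (scut_il _ _).trans ih.il
      | tl _ _ _ f ih => exact (scut_tl _ _).trans (HE.tl ih)
      | ir => exact scut_ir_il c)
    (by intro X S Γ Δ h k hk; cases k <;> exact hk.elim)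
    (by intro X S Γ Λ Δ Δ₁ Δ₁' h k e e' hk; cases k <;> exact hk.elim)

theorem unitLift_he {c : CF none Θ C} {c' : CF none Θ' C} (h : HE c c') {a : CF S Γ Fma.unit}
    {a' : CF S Γ' Fma.unit} (ha : HE a a') : HE ((unitLift c).map a) ((unitLift c').map a') :=
  (Fam.ext_unit (unitLift c).toFam (unitLift c').toFam h a).trans ((unitLift c').he ha)

theorem unitLift_ccut (c : CF none Δ C) (h : CF none Γ' X) (a : CF S Γ Fma.unit)
    (e : Δ = Λ ++ X :: Λ') (e' : Γ ++ Δ = Δ' ++ X :: Δ₁') (eΔ : Δ' = Γ ++ Λ) :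
    HE (ccutCF Δ' h ((unitLift c).map a) e') ((unitLift (ccutCF Λ h c e)).map a) := by
  subst e
  refine (((unitLift c).toFam.ccut_map h a e' eΔ).symm).trans ?_
  refine Fam.ext_unit _ (unitLift (ccutCF Λ h c rfl)).toFam ?_ a
  exact (Fam.ccut_map _ h .Ir (by simp) rfl).trans (.refl _)

/-! ### Interpretation of categorical derivations -/

def Act.id (A : Fma V) : Act A [] A :=
  Act.ofFam
    { map := fun f => castCtx (by simp) f
      cong := fun h => (castCtx_he _ _).trans ((HE.of h).trans (castCtx_he _ _).symm)
      uf := fun _ => (castCtx_he _ _).trans (castCtx_he _ _).symm.uf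
      il := fun _ => (castCtx_he _ _).trans (castCtx_he _ _).symm.il
      tl := fun _ => (castCtx_he _ _).trans (HE.tl (castCtx_he _ _).symm) }
    (fun h => (scut_he h (castCtx_he rfl _)).trans ((scut_ax h).trans (castCtx_he _ _).symm))
    (fun h _ _ => (scut_he h (castCtx_he _ _)).trans (castCtx_he _ _).symm)
    (fun h _ e _ _ => (ccut_he (castCtx_he _ _) h _ e rfl).trans (castCtx_he _ _).symm)

def Act.comp (ψ : Act B [] C) (φ : Act A [] B) : Act A [] C where
  toFam := ψ.toFam.comp φ.toFam
  scut h k _ :=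
    (scut_he h (Fam.comp_map _ _ _)).trans <| (ψ.scut h _ trivial).trans <|
      (ψ.he (φ.scut h k trivial)).trans (Fam.comp_map _ _ _).symm
  ccut h k e e' _ :=
    have e₁ := (List.append_nil _).trans e
    (ccut_he (Fam.comp_map _ _ _) h _ (by simpa using e) rfl).trans <|
      (ψ.ccut h _ e₁ (by simpa using e) trivial).trans <|
      (ψ.he (φ.ccut h k e e₁ trivial)).trans (Fam.comp_map _ _ _).symm

def Bil.tens (φ : Act A [] C) (ψ : Act B [] D) : Bil A B [] (C.tens D) where
  map a b := castCtx (by simp) (.tr (φ.map a) (ψ.map b))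
  he h h' := (castCtx_he _ _).trans ((HE.tr (φ.he h) (ψ.he h')).trans (castCtx_he _ _).symm)
  uf _ _ := (castCtx_he _ _).trans <| (HE.tr (φ.uf _) (.refl _)).trans <| (tr_uf _ _).trans
    (castCtx_he _ _).symm.uf
  il _ _ := (castCtx_he _ _).trans <| (HE.tr (φ.il _) (.refl _)).trans <| (tr_il _ _).trans
    (castCtx_he _ _).symm.il
  tl _ _ := (castCtx_he _ _).trans <| (HE.tr (φ.tl _) (.refl _)).trans <| (tr_tl _ _).trans
    (HE.tl (castCtx_he _ _).symm)
  scut h a b := (scut_he h (castCtx_he _ _)).trans <| (scut_tr _ _ _).trans <|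
    (HE.tr (φ.scut h a trivial) (.refl _)).trans (castCtx_he _ _).symm
  ccut_left h a b e e' :=
    have e₁ := (List.append_nil _).trans e
    (ccut_he (castCtx_he _ _) h _ (by simpa using e') rfl).trans <|
      (ccut_tr_left _ _ _ _ e₁).trans <|
      (HE.tr (φ.ccut h a e e₁ trivial) (.refl _)).trans (castCtx_he _ _).symm
  ccut_right h a b e e' eΔ :=
    have e₁ := (List.append_nil _).trans e
    (ccut_he (castCtx_he _ _) h _ (by simp [e, eΔ]) rfl).trans <|
      (ccut_tr_right _ _ _ _ e₁ (by simpa using eΔ)).trans <|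
      (HE.tr (.refl _) (ψ.ccut h b e e₁ trivial)).trans (castCtx_he _ _).symm

theorem Bil.tens_map (φ : Act A [] C) (ψ : Act B [] D) (a : CF S Γ A) (b : CF none Δ B) :
    HE ((Bil.tens φ ψ).map a b) (.tr (φ.map a) (ψ.map b)) := castCtx_he _ _

def Bil.lam (A : Fma V) : Bil Fma.unit A [] A where
  map a b := castCtx (by simp) ((unitLift b).map a)
  he h h' := (castCtx_he _ _).trans ((unitLift_he h' h).trans (castCtx_he _ _).symm)
  uf _ b := (castCtx_he _ _).trans <| ((unitLift b).uf _).trans (castCtx_he _ _).symm.uf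
  il _ b := (castCtx_he _ _).trans <| ((unitLift b).il _).trans (castCtx_he _ _).symm.il
  tl _ b := (castCtx_he _ _).trans <| ((unitLift b).tl _).trans (HE.tl (castCtx_he _ _).symm)
  scut h a b := (scut_he h (castCtx_he _ _)).trans <|
    ((unitLift b).scut h a trivial).trans (castCtx_he _ _).symm
  ccut_left h a b e e' :=
    have e₁ := (List.append_nil _).symm.trans e'
    (ccut_he (castCtx_he _ _) h _ e₁ rfl).trans <|
      ((unitLift b).ccut h a e e₁ trivial).trans (castCtx_he _ _).symm
  ccut_right h a b e e' eΔ :=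
    have e₁ := (List.append_nil _).symm.trans e'
    (ccut_he (castCtx_he _ _) h _ e₁ rfl).trans <|
      (unitLift_ccut b h a e e₁ eΔ).trans (castCtx_he _ _).symm

def Act.rho (A : Fma V) : Act A [] (A.tens Fma.unit) where
  toFam := Fam.trRight A .Ir
  scut h k _ := scut_tr h k .Ir
  ccut h k e e' _ := ccut_tr_left h k .Ir e' e

def Bil.assoc (A B : Fma V) (c : CF none Θ C) : Bil A B Θ (A.tens (B.tens C)) where
  map a b := castCtx (by simp) (.tr a (.tr b c))
  he h h' := (castCtx_he _ _).trans ((HE.tr h (HE.tr h' (.refl _))).trans (castCtx_he _ _).symm)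
  uf _ _ := (castCtx_he _ _).trans ((tr_uf _ _).trans (castCtx_he _ _).symm.uf)
  il _ _ := (castCtx_he _ _).trans ((tr_il _ _).trans (castCtx_he _ _).symm.il)
  tl _ _ := (castCtx_he _ _).trans ((tr_tl _ _).trans (HE.tl (castCtx_he _ _).symm))
  scut h _ _ := (scut_he h (castCtx_he _ _)).trans ((scut_tr _ _ _).trans (castCtx_he _ _).symm)
  ccut_left h _ _ e e' := (ccut_he (castCtx_he _ _) h _ (by simpa using e') rfl).trans <|
    (ccut_tr_left _ _ _ _ e).trans (castCtx_he _ _).symm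
  ccut_right {S X Γ Γ' Δ Λ Λ' Λ₁ Λ₁'} h a b e e' eΔ := by
    have e₁ : Γ ++ (Δ ++ Θ) = Λ' ++ X :: (Λ₁ ++ Θ) := by simp [e, eΔ]
    have e₂ : Δ ++ Θ = Λ ++ X :: (Λ₁ ++ Θ) := by simp [e]
    exact (ccut_he (castCtx_he _ _) h _ e₁ rfl).trans <| (ccut_tr_right _ _ _ _ e₂ eΔ).trans <|
      (HE.tr (.refl _) (ccut_tr_left _ _ _ _ e)).trans (castCtx_he _ _).symm

theorem Bil.assoc_map (a : CF S Γ A) (b : CF none Δ B) (c : CF none Θ C) :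
    HE ((Bil.assoc A B c).map a b) (.tr a (.tr b c)) := castCtx_he _ _

theorem Bil.assoc_lift_he {c : CF none Θ C} {c' : CF none Θ' C} (h : HE c c')
    {f : CF S Γ (A.tens B)} {f' : CF S Γ' (A.tens B)} (hf : HE f f') :
    HE ((Bil.assoc A B c).lift.map f) ((Bil.assoc A B c').lift.map f') := by
  refine (Fam.ext_tens _ (Bil.assoc A B c').lift.toFam (fun a b => ?_) f).trans
    ((Bil.assoc A B c').lift.he hf)
  exact (Bil.assoc_map a b c).trans <| (HE.tr (.refl _) (HE.tr (.refl _) h)).trans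
    (Bil.assoc_map a b c').symm

theorem Bil.assoc_lift_ccut (c : CF none Δ C) (h : CF none Γ' X) (f : CF S Γ (A.tens B))
    (e : Δ = Λ ++ X :: Λ') (e' : Γ ++ Δ = Δ' ++ X :: Δ₁') (eΔ : Δ' = Γ ++ Λ) :
    HE (ccutCF Δ' h ((Bil.assoc A B c).lift.map f) e')
      ((Bil.assoc A B (ccutCF Λ h c e)).lift.map f) := by
  subst e
  refine (((Bil.assoc A B c).lift.toFam.ccut_map h f e' eΔ).symm).trans ?_
  refine Fam.ext_tens _ (Bil.assoc A B (ccutCF Λ h c rfl)).lift.toFam (fun {S Γ₁ Δ₁} a b => ?_) f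
  refine (Fam.ccut_map _ h (.tr a b) (Δ₁' := Λ') (by simp) rfl).trans ?_
  have e₁ : Γ₁ ++ (Δ₁ ++ (Λ ++ X :: Λ')) = Γ₁ ++ (Δ₁ ++ Λ) ++ X :: Λ' := by simp
  have e₂ : Δ₁ ++ (Λ ++ X :: Λ') = Δ₁ ++ Λ ++ X :: Λ' := by simp
  refine (ccut_he (Bil.assoc_map a b _) h _ e₁ (List.append_assoc _ _ _)).trans ?_
  refine (ccut_tr_right h _ _ _ e₂ rfl).trans ?_
  exact (HE.tr (.refl _) (ccut_tr_right h _ _ _ rfl rfl)).trans (Bil.assoc_map _ _ _).symm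

def Bil.alpha (A B C : Fma V) : Bil (A.tens B) C [] (A.tens (B.tens C)) where
  map f c := castCtx (by simp) ((Bil.assoc A B c).lift.map f)
  he h h' := (castCtx_he _ _).trans ((Bil.assoc_lift_he h' h).trans (castCtx_he _ _).symm)
  uf _ c := (castCtx_he _ _).trans <| ((Bil.assoc A B c).lift.uf _).trans
    (castCtx_he _ _).symm.uf
  il _ c := (castCtx_he _ _).trans <| ((Bil.assoc A B c).lift.il _).trans
    (castCtx_he _ _).symm.il
  tl _ c := (castCtx_he _ _).trans <| ((Bil.assoc A B c).lift.tl _).trans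
    (HE.tl (castCtx_he _ _).symm)
  scut h f c := (scut_he h (castCtx_he _ _)).trans <|
    ((Bil.assoc A B c).lift.scut h f trivial).trans (castCtx_he _ _).symm
  ccut_left h f c e e' :=
    have e₁ := (List.append_nil _).symm.trans e'
    (ccut_he (castCtx_he _ _) h _ e₁ rfl).trans <|
      ((Bil.assoc A B c).lift.ccut h f e e₁ trivial).trans (castCtx_he _ _).symm
  ccut_right h f c e e' eΔ :=
    have e₁ := (List.append_nil _).symm.trans e'
    (ccut_he (castCtx_he _ _) h _ e₁ rfl).trans <|
      (Bil.assoc_lift_ccut c h f e e₁ eΔ).trans (castCtx_he _ _).symm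

theorem Bil.alpha_map (f : CF S Γ (A.tens B)) (c : CF none Δ C) :
    HE ((Bil.alpha A B C).map f c) ((Bil.assoc A B c).lift.map f) := castCtx_he _ _

/-- The action of a categorical derivation on cut-free derivations by postcomposition. -/
def interp : ∀ {A C : Fma V}, Der A C → Act A [] C
  | _, _, .id => Act.id _
  | _, _, .comp g f => (interp g).comp (interp f)
  | _, _, .tens f g => (Bil.tens (interp f) (interp g)).lift
  | _, _, .lam => (Bil.lam _).lift
  | _, _, .rho => Act.rho _
  | _, _, .alpha => (Bil.alpha _ _ _).lift

theorem interp_id (h : CF S Γ A) : HE ((interp .id).map h) h := castCtx_he _ _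

theorem interp_comp (g : Der B C) (f : Der A B) (h : CF S Γ A) :
    HE ((interp (.comp g f)).map h) ((interp g).map ((interp f).map h)) := castCtx_he _ _

theorem interp_tens (f : Der A C) (g : Der B D) (a : CF S Γ A) (b : CF none Δ B) :
    HE ((interp (.tens f g)).map (.tr a b)) (.tr ((interp f).map a) ((interp g).map b)) :=
  Bil.tens_map _ _ _ _

theorem interp_lam (b : CF none Δ A) : HE ((interp .lam).map (.tr .Ir b)) b := castCtx_he _ _

theorem interp_rho (h : CF S Γ A) : HE ((interp .rho).map h) (.tr h .Ir) := .refl _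

theorem interp_alpha (a : CF S Γ A) (b : CF none Δ B) (c : CF none Θ C) :
    HE ((interp .alpha).map (.tr (.tr a b) c)) (.tr a (.tr b c)) :=
  (Bil.alpha_map _ _).trans (Bil.assoc_map _ _ _)

/-! ### Soundness and the comparison with the completeness translation -/

theorem Fam.ext_unit_tens (φ : Fam (Fma.unit.tens B) Θ C) (ψ : Fam (Fma.unit.tens B) Θ' C)
    (h : ∀ {Δ : List (Fma V)} (b : CF none Δ B), HE (φ.map (.tr .Ir b)) (ψ.map (.tr .Ir b)))
    (k : CF S Γ (Fma.unit.tens B)) : HE (φ.map k) (ψ.map k) := by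
  refine Fam.ext_tens φ ψ (fun a b => ?_) k
  refine (Fam.comp_map φ (.trRight _ b) a).symm.trans <|
    (Fam.ext_unit _ (ψ.comp (.trRight _ b)) ?_ a).trans (Fam.comp_map _ _ _)
  exact (Fam.comp_map _ _ _).trans ((h b).trans (Fam.comp_map ψ (.trRight _ b) .Ir).symm)

theorem Fam.ext_tens_tens (φ : Fam ((A.tens B).tens C) Θ D) (ψ : Fam ((A.tens B).tens C) Θ' D)
    (h : ∀ {S : Stp V} {Γ Δ Λ : List (Fma V)} (a : CF S Γ A) (b : CF none Δ B) (c : CF none Λ C),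
      HE (φ.map (.tr (.tr a b) c)) (ψ.map (.tr (.tr a b) c)))
    (k : CF S Γ ((A.tens B).tens C)) : HE (φ.map k) (ψ.map k) := by
  refine Fam.ext_tens φ ψ (fun l c => ?_) k
  refine (Fam.comp_map φ (.trRight _ c) l).symm.trans <|
    (Fam.ext_tens _ (ψ.comp (.trRight _ c)) (fun a b => ?_) l).trans (Fam.comp_map _ _ _)
  exact (Fam.comp_map _ _ _).trans ((h a b c).trans
    (Fam.comp_map ψ (.trRight _ c) (.tr a b)).symm)

theorem interp_sound {f g : Der A C} (e : DerEq f g) :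
    ∀ {S : Stp V} {Γ : List (Fma V)} (h : CF S Γ A),
      HE ((interp f).map h) ((interp g).map h) := by
  induction e with
  | refl => intros; exact .refl _
  | symm _ ih => intro _ _ h; exact (ih h).symm
  | trans _ _ ih ih' => intro _ _ h; exact (ih h).trans (ih' h)
  | compCong _ _ ih ih' =>
    intro _ _ h
    exact (interp_comp _ _ h).trans <| ((interp _).he (ih' h)).trans <| (ih _).trans
      (interp_comp _ _ h).symm
  | tensCong _ _ ih ih' =>
    intro _ _ h
    refine Fam.ext_tens (interp _).toFam (interp _).toFam (fun a b => ?_) h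
    exact (interp_tens _ _ a b).trans ((HE.tr (ih a) (ih' b)).trans (interp_tens _ _ a b).symm)
  | compIdL => intro _ _ h; exact (interp_comp _ _ h).trans (interp_id _)
  | compIdR => intro _ _ h; exact (interp_comp _ _ h).trans ((interp _).he (interp_id h))
  | compAssoc =>
    intro _ _ h
    exact (interp_comp _ _ h).trans <| ((interp _).he (interp_comp _ _ h)).trans <|
      (interp_comp _ _ _).symm.trans (interp_comp _ _ h).symm
  | tensId =>
    intro _ _ h
    refine Fam.ext_tens (interp _).toFam (interp _).toFam (fun a b => ?_) h
    exact (interp_tens _ _ a b).trans <| (HE.tr (interp_id a) (interp_id b)).trans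
      (interp_id _).symm
  | tensComp =>
    intro _ _ h
    refine Fam.ext_tens (interp _).toFam (interp _).toFam (fun a b => ?_) h
    exact (interp_tens _ _ a b).trans <| (HE.tr (interp_comp _ _ a) (interp_comp _ _ b)).trans <|
      (interp_tens _ _ _ _).symm.trans <|
      ((interp _).he (interp_tens _ _ a b)).symm.trans (interp_comp _ _ _).symm
  | natLam =>
    intro _ _ h
    refine Fam.ext_unit_tens (interp _).toFam (interp _).toFam (fun b => ?_) h
    exact (interp_comp _ _ _).trans <| ((interp _).he (interp_lam b)).trans <|
      (interp_lam _).symm.trans <|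
      ((interp .lam).he ((interp_tens _ _ _ _).trans
        (HE.tr (interp_id _) (.refl _)))).symm.trans (interp_comp _ _ _).symm
  | natRho =>
    intro _ _ h
    exact (interp_comp _ _ h).trans <| (interp_rho _).trans <|
      (HE.tr (.refl _) (interp_id _)).symm.trans <| (interp_tens _ _ _ _).symm.trans <|
      ((interp _).he (interp_rho h)).symm.trans (interp_comp _ _ _).symm
  | natAlpha =>
    intro _ _ h
    refine Fam.ext_tens_tens (interp _).toFam (interp _).toFam (fun a b c => ?_) h
    refine (interp_comp _ _ _).trans <| ((interp _).he ((interp_tens _ _ _ _).trans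
      (HE.tr (interp_tens _ _ _ _) (.refl _)))).trans <| (interp_alpha _ _ _).trans <|
      HE.trans ?_ (((interp _).he (interp_alpha a b c)).symm.trans (interp_comp _ _ _).symm)
    exact (HE.tr (.refl _) (interp_tens _ _ _ _)).symm.trans (interp_tens _ _ _ _).symm
  | lamRho =>
    intro _ _ h
    refine Fam.ext_unit (interp _).toFam (interp _).toFam ?_ h
    exact (interp_comp _ _ _).trans <| ((interp _).he (interp_rho _)).trans <|
      (interp_lam _).trans (interp_id _).symm
  | skewB =>
    intro _ _ h
    refine Fam.ext_tens (interp _).toFam (interp _).toFam (fun a b => ?_) h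
    refine (interp_comp _ _ _).trans <| ((interp _).he ((interp_comp _ _ _).trans <|
      ((interp _).he ((interp_tens _ _ _ _).trans
        (HE.tr (interp_rho _) (interp_id _)))).trans (interp_alpha _ _ _))).trans <|
      (interp_tens _ _ _ _).trans <| (HE.tr (interp_id _) (interp_lam _)).trans (interp_id _).symm
  | skewC =>
    intro _ _ h
    refine Fam.ext_tens (interp _).toFam (interp _).toFam (fun k c => ?_) h
    refine (Fam.comp_map (interp _).toFam (.trRight _ c) k).symm.trans <|
      (Fam.ext_unit_tens _ ((interp _).toFam.comp (.trRight _ c)) (fun b => ?_) k).trans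
        (Fam.comp_map _ _ _)
    refine (Fam.comp_map _ _ _).trans (HE.trans ?_ (Fam.comp_map _ _ _).symm)
    exact (interp_comp _ _ _).trans <| ((interp _).he (interp_alpha _ _ _)).trans <|
      (interp_lam _).trans <| (HE.tr (interp_lam _) (interp_id _)).symm.trans
      (interp_tens _ _ _ _).symm
  | skewD =>
    intro _ _ h
    refine Fam.ext_tens (interp _).toFam (interp _).toFam (fun a b => ?_) h
    exact (interp_comp _ _ _).trans <| ((interp _).he (interp_rho _)).trans <|
      (interp_alpha _ _ _).trans <| (HE.tr (interp_id _) (interp_rho _)).symm.trans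
      (interp_tens _ _ _ _).symm
  | skewE =>
    intro _ _ h
    refine Fam.ext_tens (interp _).toFam (interp _).toFam (fun k d => ?_) h
    refine (Fam.comp_map (interp _).toFam (.trRight _ d) k).symm.trans <|
      (Fam.ext_tens_tens _ ((interp _).toFam.comp (.trRight _ d)) (fun a b c => ?_) k).trans
        (Fam.comp_map _ _ _)
    refine (Fam.comp_map _ _ _).trans (HE.trans ?_ (Fam.comp_map _ _ _).symm)
    refine (interp_comp _ _ _).trans <| ((interp _).he ((interp_comp _ _ _).trans <|
      ((interp _).he ((interp_tens _ _ _ _).trans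
        (HE.tr (interp_alpha _ _ _) (interp_id _)))).trans (interp_alpha _ _ _))).trans <|
      (interp_tens _ _ _ _).trans <| (HE.tr (interp_id _) (interp_alpha _ _ _)).trans ?_
    exact (((interp _).he (interp_alpha _ _ _)).trans (interp_alpha _ _ _)).symm.trans
      (interp_comp _ _ _).symm

theorem cmplt_interp (f : Der A C) : HE (cmpltCF f) ((interp f).map .ax) := by
  induction f with
  | id => exact (interp_id _).symm
  | comp g f ihg ihf =>
    exact (scut_he _ ihg).trans <| ((interp g).scut _ _ trivial).trans <|
      ((interp g).he ((scut_ax _).trans ihf)).trans (interp_comp g f .ax).symm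
  | tens f g ihf ihg =>
    refine HE.tl (HE.trans ?_ (Bil.tens_map _ _ _ _).symm)
    exact HE.tr ihf (ihg.uf.trans ((interp g).uf _).symm)
  | lam => exact HE.tl (castCtx_he rfl _).symm
  | rho => exact .refl _
  | alpha =>
    refine HE.tl (HE.trans ?_ (Bil.alpha_map _ _).symm)
    refine HE.trans (HE.tl ?_) (Bil.lift_ax _).symm
    exact (HE.tr (.refl _) (tr_uf _ _).symm).trans (Bil.assoc_map _ _ _).symm

end CF

/-- The completeness translation respects the equivalences: `f ≐ g` implies
`cmplt f ◦≐ cmplt g`. -/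
theorem statement8 (V : Type) (A C : Fma V) (f g : Der A C) (h : DerEq f g) :
    CFEq (cmpltCF f) (cmpltCF g) :=
  ((CF.cmplt_interp f).trans ((CF.interp_sound h .ax).trans (CF.cmplt_interp g).symm)).out
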